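/- Let $n\ge 3$, let $V$ be a nonzero finite-dimensional complex inner product space, and let $\gamma_1,\dots,\gamma_n:V\to V$ be complex-linear maps with $\gamma_i\gamma_j+\gamma_j\gamma_i=-2\delta_{ij}\,\mathrm{id}_V$ and $\langle\gamma_i\varphi,\psi\rangle=-\langle\varphi,\gamma_i\psi\rangle$ for all $i,j$ and all $\varphi,\psi\in V$. For $v\in\mathbb R^n$ put $\gamma(v)=\sum_i v^i\gamma_i$, for a differentiable $V$-valued function $f$ on an open subset of $\mathbb R^n$ put $Df(x)=\sum_i\gamma_i(\partial_i f(x))$ (the flat Dirac operator), and let $\omega_{n-1}$ be the volume of the unit sphere $S^{n-1}\subseteq\mathbb R^n$. Let $\alpha:\mathbb R^n\to V$ vanish outside a compact set, be smooth on $\mathbb R^n\setminus\{0\}$, and satisfy $\|\alpha(y)\|\le C|y|^{-m}$ for all $y\ne 0$, for some constant $C>0$ and some real $0\le m<n$. Then for every $x\ne 0$ the integral in $$\beta(x):=-\frac{1}{\omega_{n-1}}\int_{\mathbb R^n}\frac{1}{|x-y|^{n}}\,\gamma(x-y)(\alpha(y))\,dy$$ converges absolutely, the function $\beta$ is smooth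 on $\mathbb R^n\setminus\{0\}$, and $D\beta(x)=\alpha(x)$ for all $x\ne 0$. -/

import Mathlib

open MeasureTheory
open scoped InnerProductSpace

/-- Clifford multiplication `γ(v) = ∑ i, vⁱ γᵢ` applied to a spinor. -/
noncomputable def cliffordMul {n : ℕ} {V : Type*} [NormedAddCommGroup V]
    [NormedSpace ℂ V] (γ : Fin n → V →ₗ[ℂ] V)
    (v : EuclideanSpace ℝ (Fin n)) (ψ : V) : V :=
  ∑ i, v i • γ i ψ

/-- The flat Dirac operator `Df(x) = ∑ i, γᵢ (∂ᵢ f (x))`. -/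
noncomputable def dirac {n : ℕ} {V : Type*} [NormedAddCommGroup V]
    [NormedSpace ℂ V] (γ : Fin n → V →ₗ[ℂ] V)
    (f : EuclideanSpace ℝ (Fin n) → V) (x : EuclideanSpace ℝ (Fin n)) : V :=
  ∑ i, γ i (fderiv ℝ f x (EuclideanSpace.single i 1))

/-- `ω_{n-1}`, the total mass of the surface measure that Lebesgue measure on `ℝⁿ`
induces on the unit sphere `S^{n-1}`. -/
noncomputable def sphereVol (n : ℕ) : ℝ :=
  (volume : Measure (EuclideanSpace ℝ (Fin n))).toSphere.real Set.univ

/-- The integrand `|x-y|^{-n} γ(x-y)(α(y))`. -/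
noncomputable def greenIntegrand {n : ℕ} {V : Type*} [NormedAddCommGroup V]
    [NormedSpace ℂ V] (γ : Fin n → V →ₗ[ℂ] V)
    (α : EuclideanSpace ℝ (Fin n) → V) (x y : EuclideanSpace ℝ (Fin n)) : V :=
  (‖x - y‖ ^ n)⁻¹ • cliffordMul γ (x - y) (α y)

/-- `β(x) = -ω_{n-1}⁻¹ ∫ |x-y|^{-n} γ(x-y)(α(y)) dy`, the convolution of `α` with the
Green's function `-γ(x) / (ω_{n-1} |x|^n)` of the flat Dirac operator. The sign is the one
that belongs to the convention `γ(x)² = -|x|²`. -/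
noncomputable def greenConv {n : ℕ} {V : Type*} [NormedAddCommGroup V]
    [NormedSpace ℂ V] (γ : Fin n → V →ₗ[ℂ] V)
    (α : EuclideanSpace ℝ (Fin n) → V) (x : EuclideanSpace ℝ (Fin n)) : V :=
  -((sphereVol n)⁻¹ • ∫ y, greenIntegrand γ α x y)

section GreenKernel

open Filter Topology Metric Set

variable {n : ℕ} {V : Type*} [NormedAddCommGroup V] [NormedSpace ℝ V]

/-- Clifford multiplication as a continuous linear map in the vector and in the spinor. -/
noncomputable def cliffordCLM (γ : Fin n → V →L[ℝ] V) :
    EuclideanSpace ℝ (Fin n) →L[ℝ] V →L[ℝ] V :=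
  ∑ i, (EuclideanSpace.proj i : EuclideanSpace ℝ (Fin n) →L[ℝ] ℝ).smulRight (γ i)

/-- The regularised kernel `(|z|² + e)^{-n/2} γ(z)`; for `e = 0` it is `|z|^{-n} γ(z)`. -/
noncomputable def greenKernel (γ : Fin n → V →L[ℝ] V) (e : ℝ) (z : EuclideanSpace ℝ (Fin n)) :
    V →L[ℝ] V :=
  (‖z‖ ^ 2 + e) ^ (-(n : ℝ) / 2) • cliffordCLM γ z

theorem cliffordCLM_apply (γ : Fin n → V →L[ℝ] V) (v : EuclideanSpace ℝ (Fin n)) (ψ : V) :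
    cliffordCLM γ v ψ = ∑ i, v i • γ i ψ := by
  simp [cliffordCLM]

theorem cliffordCLM_single (γ : Fin n → V →L[ℝ] V) (i : Fin n) :
    cliffordCLM γ (EuclideanSpace.single i 1) = γ i := by
  ext ψ
  rw [cliffordCLM_apply, Finset.sum_eq_single i] <;> simp +contextual

theorem cliffordCLM_sq {γ : Fin n → V →L[ℝ] V}
    (hcl : ∀ i j (ψ : V), γ i (γ j ψ) + γ j (γ i ψ) = if i = j then (-2 : ℝ) • ψ else 0)
    (v : EuclideanSpace ℝ (Fin n)) (ψ : V) :
    cliffordCLM γ v (cliffordCLM γ v ψ) = -(‖v‖ ^ 2 • ψ) := by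
  have h1 : cliffordCLM γ v (cliffordCLM γ v ψ) = ∑ i, ∑ j, (v i * v j) • γ i (γ j ψ) := by
    simp only [cliffordCLM_apply, map_sum, map_smul, Finset.smul_sum, mul_smul]
    rw [Finset.sum_comm]
    exact Finset.sum_congr rfl fun i _ => Finset.sum_congr rfl fun j _ => smul_comm _ _ _
  have h2 : cliffordCLM γ v (cliffordCLM γ v ψ) = ∑ i, ∑ j, (v i * v j) • γ j (γ i ψ) := by
    rw [h1, Finset.sum_comm]
    simp only [mul_comm]
  have h3 : (2 : ℝ) • cliffordCLM γ v (cliffordCLM γ v ψ) = (2 : ℝ) • -(‖v‖ ^ 2 • ψ) := by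
    rw [two_smul]
    nth_rewrite 1 [h1]
    rw [h2]
    simp only [← Finset.sum_add_distrib, ← smul_add, hcl, smul_ite, smul_zero,
      Finset.sum_ite_eq, Finset.mem_univ, if_true, EuclideanSpace.real_norm_sq_eq, smul_smul,
      ← Finset.sum_smul, ← neg_smul]
    congr 1
    rw [← Finset.sum_mul]
    simp only [pow_two]
    ring
  exact smul_right_injective V (two_ne_zero (α := ℝ)) h3

theorem clifford_self {γ : Fin n → V →L[ℝ] V}
    (hcl : ∀ i j (ψ : V), γ i (γ j ψ) + γ j (γ i ψ) = if i = j then (-2 : ℝ) • ψ else 0)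
    (i : Fin n) (ψ : V) : γ i (γ i ψ) = -ψ := by
  have := cliffordCLM_sq hcl (EuclideanSpace.single i 1) ψ
  simpa [cliffordCLM_single] using this

theorem hasFDerivAt_norm_sq_add_rpow {E : Type*} [NormedAddCommGroup E] [InnerProductSpace ℝ E]
    (e p : ℝ) {z : E} (hz : 0 < ‖z‖ ^ 2 + e) :
    HasFDerivAt (fun z : E => (‖z‖ ^ 2 + e) ^ p)
      ((p * (‖z‖ ^ 2 + e) ^ (p - 1)) • (2 : ℝ) • innerSL ℝ z) z := by
  have h : HasFDerivAt (fun z : E => ‖z‖ ^ 2 + e) ((2 : ℝ) • innerSL ℝ z) z := by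
    have := (hasStrictFDerivAt_norm_sq z).hasFDerivAt.add_const e
    simpa [ofNat_smul_eq_nsmul] using this
  exact h.rpow_const (Or.inl hz.ne')

theorem hasFDerivAt_greenKernel (γ : Fin n → V →L[ℝ] V) (e : ℝ) {z : EuclideanSpace ℝ (Fin n)}
    (hz : 0 < ‖z‖ ^ 2 + e) :
    HasFDerivAt (greenKernel γ e)
      ((‖z‖ ^ 2 + e) ^ (-(n : ℝ) / 2) • cliffordCLM γ +
        (((-(n : ℝ) / 2) * (‖z‖ ^ 2 + e) ^ (-(n : ℝ) / 2 - 1)) • (2 : ℝ) • innerSL ℝ z).smulRight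
          (cliffordCLM γ z)) z :=
  (hasFDerivAt_norm_sq_add_rpow e _ hz).smul (cliffordCLM γ).hasFDerivAt

theorem contDiffAt_greenKernel (γ : Fin n → V →L[ℝ] V) (e : ℝ) {z : EuclideanSpace ℝ (Fin n)}
    (hz : 0 < ‖z‖ ^ 2 + e) {k : WithTop ℕ∞} : ContDiffAt ℝ k (greenKernel γ e) z := by
  have h : ContDiffAt ℝ k (fun z : EuclideanSpace ℝ (Fin n) =>
      (‖z‖ ^ 2 + e) ^ (-(n : ℝ) / 2)) z :=
    ((contDiff_norm_sq ℝ).contDiffAt.add contDiffAt_const).rpow_const_of_ne hz.ne'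
  exact h.smul (cliffordCLM γ).contDiff.contDiffAt

/-- The Dirac operator applied to the regularised kernel. -/
theorem sum_clifford_fderiv_greenKernel {γ : Fin n → V →L[ℝ] V}
    (hcl : ∀ i j (ψ : V), γ i (γ j ψ) + γ j (γ i ψ) = if i = j then (-2 : ℝ) • ψ else 0)
    (e : ℝ) {z : EuclideanSpace ℝ (Fin n)} (hz : 0 < ‖z‖ ^ 2 + e) (ψ : V) :
    ∑ i, γ i (fderiv ℝ (greenKernel γ e) z (EuclideanSpace.single i 1) ψ) =
      -((n * e * (‖z‖ ^ 2 + e) ^ (-(n : ℝ) / 2 - 1)) • ψ) := by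
  rw [(hasFDerivAt_greenKernel γ e hz).fderiv]
  set s := ‖z‖ ^ 2 + e with hs
  have hpow : s ^ (-(n : ℝ) / 2) = s ^ (-(n : ℝ) / 2 - 1) * s := by
    rw [Real.rpow_sub_one hz.ne', div_mul_cancel₀ _ hz.ne']
  have h1 : ∀ i, γ i ((s ^ (-(n : ℝ) / 2) • cliffordCLM γ +
        (((-(n : ℝ) / 2) * s ^ (-(n : ℝ) / 2 - 1)) • (2 : ℝ) • innerSL ℝ z).smulRight
          (cliffordCLM γ z)) (EuclideanSpace.single i 1) ψ) =
      -(s ^ (-(n : ℝ) / 2) • ψ) +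
        (-(n : ℝ) * s ^ (-(n : ℝ) / 2 - 1)) • z i • γ i (cliffordCLM γ z ψ) := by
    intro i
    simp only [add_apply, smul_apply,
      ContinuousLinearMap.smulRight_apply, cliffordCLM_single, map_add, map_smul,
      clifford_self hcl, innerSL_apply_apply, EuclideanSpace.inner_single_right, smul_neg]
    congr 1
    rw [smul_smul _ (z i)]
    congr 1
    simp
    ring
  simp only [h1]
  rw [Finset.sum_add_distrib, ← Finset.smul_sum, ← cliffordCLM_apply, cliffordCLM_sq hcl, hpow]
  simp only [Finset.sum_const, Finset.card_univ, Fintype.card_fin, ← Nat.cast_smul_eq_nsmul ℝ,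
    smul_smul, ← neg_smul, ← add_smul]
  congr 1
  rw [hs]
  ring

theorem greenKernel_zero_apply (γ : Fin n → V →L[ℝ] V) (z : EuclideanSpace ℝ (Fin n)) :
    greenKernel γ 0 z = (‖z‖ ^ n)⁻¹ • cliffordCLM γ z := by
  rw [greenKernel, add_zero, ← Real.rpow_natCast ‖z‖ 2, ← Real.rpow_mul (norm_nonneg z),
    ← Real.rpow_natCast, ← Real.rpow_neg (norm_nonneg z)]
  congr 2
  push_cast
  ring

theorem norm_greenKernel_le (γ : Fin n → V →L[ℝ] V) {e : ℝ} (he : 0 ≤ e)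
    (z : EuclideanSpace ℝ (Fin n)) :
    ‖greenKernel γ e z‖ ≤ ‖cliffordCLM γ‖ * ‖z‖ ^ (-((n : ℝ) - 1)) := by
  rcases eq_or_ne z 0 with rfl | hz
  · simp only [greenKernel, map_zero, smul_zero, norm_zero]
    positivity
  have hz' : 0 < ‖z‖ := norm_pos_iff.2 hz
  rw [greenKernel, norm_smul, Real.norm_of_nonneg (by positivity)]
  have h1 : (‖z‖ ^ 2 + e) ^ (-(n : ℝ) / 2) ≤ ‖z‖ ^ (-(n : ℝ)) := by
    calc (‖z‖ ^ 2 + e) ^ (-(n : ℝ) / 2) ≤ (‖z‖ ^ 2) ^ (-(n : ℝ) / 2) :=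
          Real.rpow_le_rpow_of_nonpos (by positivity) (by linarith)
            (by have : (0 : ℝ) ≤ n := n.cast_nonneg
                linarith)
      _ = ‖z‖ ^ (-(n : ℝ)) := by
          rw [← Real.rpow_natCast ‖z‖ 2, ← Real.rpow_mul hz'.le]
          congr 1
          push_cast
          ring
  calc _ ≤ ‖z‖ ^ (-(n : ℝ)) * (‖cliffordCLM γ‖ * ‖z‖) := by
        gcongr
        exact (cliffordCLM γ).le_opNorm z
    _ = _ := by
        rw [neg_sub, sub_eq_add_neg, Real.rpow_add hz', Real.rpow_one]
        ring

theorem aestronglyMeasurable_greenKernel (γ : Fin n → V →L[ℝ] V) (e : ℝ) :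
    AEStronglyMeasurable (greenKernel γ e) volume := by
  have h : Measurable fun z : EuclideanSpace ℝ (Fin n) => (‖z‖ ^ 2 + e) ^ (-(n : ℝ) / 2) := by
    fun_prop
  exact h.aestronglyMeasurable.smul (cliffordCLM γ).continuous.aestronglyMeasurable

theorem locallyIntegrable_greenKernel (hn : 1 ≤ n) (γ : Fin n → V →L[ℝ] V) {e : ℝ} (he : 0 ≤ e) :
    LocallyIntegrable (greenKernel γ e) volume :=
  locallyIntegrable_of_norm_le_rpow (by simpa using hn) (by simp)
    (Eventually.of_forall (norm_greenKernel_le γ he)) (aestronglyMeasurable_greenKernel γ e)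

theorem tendsto_greenKernel (γ : Fin n → V →L[ℝ] V) {z : EuclideanSpace ℝ (Fin n)} (hz : z ≠ 0) :
    Tendsto (fun e => greenKernel γ e z) (𝓝[>] 0) (𝓝 (greenKernel γ 0 z)) := by
  have : ContinuousAt (fun e => greenKernel γ e z) 0 := by
    have h : ContinuousAt (fun e : ℝ => (‖z‖ ^ 2 + e) ^ (-(n : ℝ) / 2)) 0 :=
      (continuousAt_const.add continuousAt_id).rpow_const (Or.inl (by simpa using hz))
    exact h.smul continuousAt_const
  exact this.tendsto.mono_left nhdsWithin_le_nhds

/-- The total mass of the approximate identity `n (1 + |z|²)^{-n/2-1}`. -/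
theorem integral_one_add_norm_sq_rpow (hn : 1 ≤ n) :
    Integrable (fun z : EuclideanSpace ℝ (Fin n) =>
      n * (1 + ‖z‖ ^ 2) ^ (-(n : ℝ) / 2 - 1)) volume ∧
    ∫ z : EuclideanSpace ℝ (Fin n), n * (1 + ‖z‖ ^ 2) ^ (-(n : ℝ) / 2 - 1) = sphereVol n := by
  have : Nonempty (Fin n) := ⟨⟨0, hn⟩⟩
  have hint : Integrable (fun z : EuclideanSpace ℝ (Fin n) =>
      n * (1 + ‖z‖ ^ 2) ^ (-(n : ℝ) / 2 - 1)) volume := by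
    have := (integrable_rpow_neg_one_add_norm_sq (μ := volume) (E := EuclideanSpace ℝ (Fin n))
      (r := n + 2) (by simp)).const_mul (n : ℝ)
    convert! this using 4
    ring
  refine ⟨hint, ?_⟩
  set f : ℝ → ℝ := fun r => n * (1 + r ^ 2) ^ (-(n : ℝ) / 2 - 1) with hf
  have hint' := (integrable_fun_norm_addHaar (volume : Measure (EuclideanSpace ℝ (Fin n)))
    (f := f)).1 hint
  have key : ∫ r in Ioi (0 : ℝ), r ^ (n - 1) • f r = 1 := by
    have hd : ∀ r ∈ Ioi (0 : ℝ), HasDerivAt (fun r : ℝ => r ^ n * (1 + r ^ 2) ^ (-(n : ℝ) / 2))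
        (r ^ (n - 1) • f r) r := by
      intro r hr
      have hr : 0 < r := hr
      have hs : (0 : ℝ) < 1 + r ^ 2 := by positivity
      have h := (hasDerivAt_pow n r).mul
        ((((hasDerivAt_pow 2 r).const_add 1).rpow_const (p := -(n : ℝ) / 2) (Or.inl hs.ne')))
      convert! h using 1
      have hpow : (1 + r ^ 2) ^ (-(n : ℝ) / 2) = (1 + r ^ 2) ^ (-(n : ℝ) / 2 - 1) * (1 + r ^ 2) := by
        rw [Real.rpow_sub_one hs.ne', div_mul_cancel₀ _ hs.ne']
      obtain ⟨k, rfl⟩ : ∃ k, n = k + 1 := ⟨n - 1, by omega⟩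
      simp only [hf, hpow, smul_eq_mul, Nat.add_sub_cancel]
      push_cast
      ring
    have hcont : ContinuousWithinAt (fun r : ℝ => r ^ n * (1 + r ^ 2) ^ (-(n : ℝ) / 2))
        (Ici 0) 0 := by
      refine ContinuousAt.continuousWithinAt ?_
      refine (continuousAt_id.pow n).mul ?_
      exact (continuousAt_const.add (continuousAt_id.pow 2)).rpow_const (Or.inl (by simp))
    have hlim : Tendsto (fun r : ℝ => r ^ n * (1 + r ^ 2) ^ (-(n : ℝ) / 2)) atTop (𝓝 1) := by
      have h1 : Tendsto (fun r : ℝ => ((r ^ 2)⁻¹ + 1) ^ (-(n : ℝ) / 2)) atTop (𝓝 1) := by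
        have h0 : Tendsto (fun r : ℝ => (r ^ 2)⁻¹ + 1) atTop (𝓝 (0 + 1)) :=
          (tendsto_inv_atTop_zero.comp (tendsto_pow_atTop two_ne_zero)).add_const 1
        have := h0.rpow_const (p := -(n : ℝ) / 2) (Or.inl (by simp))
        simpa using this
      refine h1.congr' ?_
      filter_upwards [eventually_gt_atTop 0] with r hr
      have hr2 : (1 + r ^ 2) = r ^ 2 * ((r ^ 2)⁻¹ + 1) := by field_simp
      rw [hr2, Real.mul_rpow (by positivity) (by positivity), ← Real.rpow_natCast r 2,
        ← Real.rpow_mul hr.le, ← mul_assoc, ← Real.rpow_natCast r n, ← Real.rpow_add hr]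
      push_cast
      rw [show (n : ℝ) + 2 * (-n / 2) = 0 by ring, Real.rpow_zero, one_mul]
    have := integral_Ioi_of_hasDerivAt_of_tendsto hcont hd (by simpa using hint') hlim
    rw [this, zero_pow (by omega)]
    simp
  have h := integral_fun_norm_addHaar (volume : Measure (EuclideanSpace ℝ (Fin n))) f
  rw [finrank_euclideanSpace_fin, key] at h
  rw [sphereVol, Measure.toSphere_real_apply_univ, finrank_euclideanSpace_fin]
  simpa [hf] using h

end GreenKernel

section FundamentalSolution

open Filter Topology Metric Set

variable {n : ℕ} {V : Type*} [NormedAddCommGroup V] [NormedSpace ℝ V]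

/-- Integration by parts against the regularised kernel. -/
theorem sum_clifford_integral_greenKernel_of_pos [CompleteSpace V] {γ : Fin n → V →L[ℝ] V}
    (hcl : ∀ i j (ψ : V), γ i (γ j ψ) + γ j (γ i ψ) = if i = j then (-2 : ℝ) • ψ else 0)
    {g : EuclideanSpace ℝ (Fin n) → V} (hg : ContDiff ℝ 1 g) (hgc : HasCompactSupport g)
    {e : ℝ} (he : 0 < e) (x : EuclideanSpace ℝ (Fin n)) :
    ∑ i, γ i (∫ y, greenKernel γ e y (fderiv ℝ g (x - y) (EuclideanSpace.single i 1))) =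
      -∫ y, (n * e * (‖y‖ ^ 2 + e) ^ (-(n : ℝ) / 2 - 1)) • g (x - y) := by
  have hpos : ∀ y : EuclideanSpace ℝ (Fin n), 0 < ‖y‖ ^ 2 + e := fun y => by positivity
  have hK : ContDiff ℝ 1 (greenKernel γ e) :=
    contDiff_iff_contDiffAt.2 fun y => contDiffAt_greenKernel γ e (hpos y)
  have hg' : Continuous (fderiv ℝ g) := hg.continuous_fderiv one_ne_zero
  have hK' : Continuous (fderiv ℝ (greenKernel γ e)) := hK.continuous_fderiv one_ne_zero
  have hsubc : Continuous fun y : EuclideanSpace ℝ (Fin n) => x - y :=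
    continuous_const.sub continuous_id
  have hcs : HasCompactSupport fun y => g (x - y) := hgc.comp_homeomorph (Homeomorph.subLeft x)
  have hcs' : HasCompactSupport fun y => fderiv ℝ g (x - y) :=
    (hgc.fderiv ℝ).comp_homeomorph (Homeomorph.subLeft x)
  have hderiv : ∀ y, HasFDerivAt (fun y => g (x - y)) (-fderiv ℝ g (x - y)) y := by
    intro y
    have h := ((hg.differentiable one_ne_zero) (x - y)).hasFDerivAt.comp y
      ((hasFDerivAt_id (𝕜 := ℝ) y).const_sub x)
    convert! h using 1
    ext v
    simp
  have hint : ∀ i : Fin n, Integrable (fun y =>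
      fderiv ℝ (greenKernel γ e) y (EuclideanSpace.single i 1) (g (x - y))) volume := by
    intro i
    refine Continuous.integrable_of_hasCompactSupport
      ((hK'.clm_apply continuous_const).clm_apply (hg.continuous.comp hsubc)) ?_
    refine hcs.mono fun y hy hy' => hy ?_
    simp only at hy'
    simp [hy']
  have hibp : ∀ i : Fin n,
      ∫ y, greenKernel γ e y (fderiv ℝ g (x - y) (EuclideanSpace.single i 1)) =
      ∫ y, fderiv ℝ (greenKernel γ e) y (EuclideanSpace.single i 1) (g (x - y)) := by
    intro i
    have h := integral_bilinear_hasFDerivAt_right_eq_neg_left_of_integrable (μ := volume)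
      (f := greenKernel γ e) (f' := fderiv ℝ (greenKernel γ e)) (g := fun y => g (x - y))
      (g' := fun y => -fderiv ℝ g (x - y)) (v := EuclideanSpace.single i 1)
      (B := ContinuousLinearMap.id ℝ (V →L[ℝ] V)) (by simpa using hint i) ?_ ?_
      (fun y _ => (hK.differentiable one_ne_zero y).hasFDerivAt) (fun y _ => hderiv y)
    · simpa [integral_neg] using h
    · refine Continuous.integrable_of_hasCompactSupport
        (hK.continuous.clm_apply ((hg'.comp hsubc).neg.clm_apply continuous_const)) ?_
      refine hcs'.mono fun y hy hy' => hy ?_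
      simp only at hy'
      simp [hy']
    · refine Continuous.integrable_of_hasCompactSupport
        (hK.continuous.clm_apply (hg.continuous.comp hsubc)) ?_
      refine hcs.mono fun y hy hy' => hy ?_
      simp only at hy'
      simp [hy']
  simp_rw [hibp, ← ContinuousLinearMap.integral_comp_comm _ (hint _)]
  rw [← integral_finsetSum _ fun i _ => (γ i).integrable_comp (hint i), ← integral_neg]
  exact integral_congr_ae (Eventually.of_forall fun y =>
    sum_clifford_fderiv_greenKernel hcl e (hpos y) _)

theorem integral_rescale_greenKernel (g : EuclideanSpace ℝ (Fin n) → V)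
    {ε : ℝ} (hε : 0 < ε) (x : EuclideanSpace ℝ (Fin n)) :
    ∫ y, (n * ε ^ 2 * (‖y‖ ^ 2 + ε ^ 2) ^ (-(n : ℝ) / 2 - 1)) • g (x - y) =
      ∫ z, (n * (1 + ‖z‖ ^ 2) ^ (-(n : ℝ) / 2 - 1)) • g (x - ε • z) := by
  have h := Measure.integral_comp_smul_of_nonneg (volume : Measure (EuclideanSpace ℝ (Fin n)))
    (fun y => (n * ε ^ 2 * (‖y‖ ^ 2 + ε ^ 2) ^ (-(n : ℝ) / 2 - 1)) • g (x - y)) ε (hR := hε.le)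
  rw [finrank_euclideanSpace_fin] at h
  have hne : (ε ^ n) ≠ 0 := by positivity
  rw [eq_comm, inv_smul_eq_iff₀ hne] at h
  rw [h, ← integral_smul]
  refine integral_congr_ae (Eventually.of_forall fun z => ?_)
  simp only
  rw [smul_smul]
  congr 1
  have h1 : ‖ε • z‖ ^ 2 + ε ^ 2 = ε ^ 2 * (1 + ‖z‖ ^ 2) := by
    rw [norm_smul, Real.norm_of_nonneg hε.le]
    ring
  rw [h1, Real.mul_rpow (by positivity) (by positivity), ← Real.rpow_natCast ε 2,
    ← Real.rpow_mul hε.le, ← Real.rpow_natCast ε n]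
  have h2 : ε ^ (n : ℝ) * ε ^ ((2 : ℕ) : ℝ) * ε ^ (((2 : ℕ) : ℝ) * (-(n : ℝ) / 2 - 1)) = 1 := by
    rw [← Real.rpow_add hε, ← Real.rpow_add hε]
    convert! Real.rpow_zero ε using 2
    push_cast
    ring
  linear_combination (n * (1 + ‖z‖ ^ 2) ^ (-(n : ℝ) / 2 - 1)) * h2

theorem tendsto_integral_approximate_identity [CompleteSpace V] (hn : 1 ≤ n)
    {g : EuclideanSpace ℝ (Fin n) → V} (hg : Continuous g) (hgc : HasCompactSupport g)
    (x : EuclideanSpace ℝ (Fin n)) :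
    Tendsto (fun ε : ℝ => ∫ z, (n * (1 + ‖z‖ ^ 2) ^ (-(n : ℝ) / 2 - 1)) • g (x - ε • z))
      (𝓝[>] 0) (𝓝 (sphereVol n • g x)) := by
  obtain ⟨hint, hval⟩ := integral_one_add_norm_sq_rpow hn
  obtain ⟨B, hB⟩ := hg.bounded_above_of_compact_support hgc
  rw [← hval, ← integral_smul_const]
  refine tendsto_integral_filter_of_dominated_convergence
    (fun z => n * (1 + ‖z‖ ^ 2) ^ (-(n : ℝ) / 2 - 1) * B) ?_ ?_ (hint.mul_const B) ?_
  · exact Eventually.of_forall fun ε => hint.aestronglyMeasurable.smul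
      (hg.comp (by fun_prop : Continuous fun z : EuclideanSpace ℝ (Fin n) =>
        x - ε • z)).aestronglyMeasurable
  · refine Eventually.of_forall fun ε => Eventually.of_forall fun z => ?_
    rw [norm_smul, Real.norm_of_nonneg (by positivity)]
    gcongr
    exact hB _
  · refine Eventually.of_forall fun z => ?_
    refine Tendsto.const_smul ?_ _
    have : Continuous fun ε : ℝ => g (x - ε • z) := hg.comp (by fun_prop)
    have h := (this.tendsto 0).mono_left (nhdsWithin_le_nhds (s := Ioi 0))
    simpa using h

theorem tendsto_integral_greenKernel (hn : 1 ≤ n) (γ : Fin n → V →L[ℝ] V)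
    {h : EuclideanSpace ℝ (Fin n) → V} (hh : Continuous h) (hhc : HasCompactSupport h) :
    Tendsto (fun e : ℝ => ∫ y, greenKernel γ e y (h y)) (𝓝[>] 0)
      (𝓝 (∫ y, greenKernel γ 0 y (h y))) := by
  have : Nonempty (Fin n) := ⟨⟨0, hn⟩⟩
  have hloc : LocallyIntegrable (fun y : EuclideanSpace ℝ (Fin n) =>
      ‖cliffordCLM γ‖ * ‖y‖ ^ (-((n : ℝ) - 1))) volume := by
    refine locallyIntegrable_of_norm_le_rpow (C := ‖cliffordCLM γ‖) (α := (n : ℝ) - 1)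
      (by simpa using hn) (by simp) (Eventually.of_forall fun y => ?_) ?_
    · rw [Real.norm_of_nonneg (by positivity)]
    · exact Measurable.aestronglyMeasurable (by fun_prop)
  refine tendsto_integral_filter_of_dominated_convergence
    (fun y => ‖cliffordCLM γ‖ * ‖y‖ ^ (-((n : ℝ) - 1)) * ‖h y‖) ?_ ?_ ?_ ?_
  · refine Eventually.of_forall fun e => ?_
    exact (ContinuousLinearMap.id ℝ (V →L[ℝ] V)).aestronglyMeasurable_comp₂
      (aestronglyMeasurable_greenKernel γ e) hh.aestronglyMeasurable
  · filter_upwards [self_mem_nhdsWithin] with e he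
    refine Eventually.of_forall fun y => ?_
    grw [ContinuousLinearMap.le_opNorm, norm_greenKernel_le γ (le_of_lt he) y]
  · exact hloc.integrable_smul_right_of_hasCompactSupport hh.norm hhc.norm
  · filter_upwards [compl_mem_ae_iff.2 (measure_singleton (μ := volume)
      (0 : EuclideanSpace ℝ (Fin n)))] with y hy
    exact ((ContinuousLinearMap.apply ℝ V (h y)).continuous.tendsto _).comp
      (tendsto_greenKernel γ hy)

/-- `-γ(z) / (ω_{n-1} |z|^n)` is a fundamental solution of the Dirac operator. -/
theorem sum_clifford_integral_greenKernel [CompleteSpace V] (hn : 1 ≤ n) {γ : Fin n → V →L[ℝ] V}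
    (hcl : ∀ i j (ψ : V), γ i (γ j ψ) + γ j (γ i ψ) = if i = j then (-2 : ℝ) • ψ else 0)
    {g : EuclideanSpace ℝ (Fin n) → V} (hg : ContDiff ℝ 1 g) (hgc : HasCompactSupport g)
    (x : EuclideanSpace ℝ (Fin n)) :
    ∑ i, γ i (∫ y, greenKernel γ 0 y (fderiv ℝ g (x - y) (EuclideanSpace.single i 1))) =
      -(sphereVol n • g x) := by
  have hsq : Tendsto (fun ε : ℝ => ε ^ 2) (𝓝[>] 0) (𝓝[>] 0) := by
    refine tendsto_nhdsWithin_iff.2 ⟨?_, ?_⟩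
    · have := ((continuous_pow 2).tendsto (0 : ℝ)).mono_left (nhdsWithin_le_nhds (s := Ioi 0))
      simpa using this
    · filter_upwards [self_mem_nhdsWithin] with ε hε
      exact pow_pos (mem_Ioi.1 hε) 2
  have h1 : Tendsto (fun ε : ℝ =>
      ∑ i, γ i (∫ y, greenKernel γ (ε ^ 2) y (fderiv ℝ g (x - y) (EuclideanSpace.single i 1))))
      (𝓝[>] 0)
      (𝓝 (∑ i, γ i (∫ y, greenKernel γ 0 y
        (fderiv ℝ g (x - y) (EuclideanSpace.single i 1))))) := by
    refine tendsto_finsetSum _ fun i _ => ((γ i).continuous.tendsto _).comp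
      ((tendsto_integral_greenKernel hn γ ?_ ?_).comp hsq)
    · exact ((hg.continuous_fderiv one_ne_zero).comp
        (continuous_const.sub continuous_id)).clm_apply continuous_const
    · refine ((hgc.fderiv ℝ).comp_homeomorph (Homeomorph.subLeft x)).mono fun y hy hy' => hy ?_
      have hy'' : fderiv ℝ g (x - y) = 0 := hy'
      simp [hy'']
  refine tendsto_nhds_unique h1
    ((tendsto_integral_approximate_identity hn hg.continuous hgc x).neg.congr' ?_)
  filter_upwards [self_mem_nhdsWithin] with ε hε
  rw [sum_clifford_integral_greenKernel_of_pos hcl hg hgc (pow_pos (mem_Ioi.1 hε) 2),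
    integral_rescale_greenKernel g hε]

end FundamentalSolution

section Green

open Filter Topology Metric Set
open scoped Convolution

variable {n : ℕ} {V : Type*} [NormedAddCommGroup V] [NormedSpace ℝ V]

/-- A smooth compactly supported density has a smooth potential, which solves the Dirac equation. -/
theorem exists_potential_of_contDiff [CompleteSpace V] (hn : 1 ≤ n) {γ : Fin n → V →L[ℝ] V}
    (hcl : ∀ i j (ψ : V), γ i (γ j ψ) + γ j (γ i ψ) = if i = j then (-2 : ℝ) • ψ else 0)
    {g : EuclideanSpace ℝ (Fin n) → V} (hg : ContDiff ℝ (⊤ : ℕ∞) g) (hgc : HasCompactSupport g) :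
    ∃ b : EuclideanSpace ℝ (Fin n) → V, ContDiff ℝ (⊤ : ℕ∞) b ∧
      (∀ x, Integrable (fun y => greenKernel γ 0 (x - y) (g y)) volume ∧
        ∫ y, greenKernel γ 0 (x - y) (g y) = b x) ∧
      ∀ x, ∑ i, γ i (fderiv ℝ b x (EuclideanSpace.single i 1)) = -(sphereVol n • g x) := by
  have hK := locallyIntegrable_greenKernel hn γ le_rfl
  have hg1 : ContDiff ℝ 1 g := hg.of_le (by exact_mod_cast le_top)
  set L := ContinuousLinearMap.id ℝ (V →L[ℝ] V)
  refine ⟨greenKernel γ 0 ⋆[L] g, hgc.contDiff_convolution_right L hK hg, fun x => ⟨?_, ?_⟩,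
    fun x => ?_⟩
  · have h := hgc.convolutionExists_right L hK hg.continuous x
    have h' := h.integrable.comp_sub_left x
    simpa [L] using h'
  · rw [convolution_eq_swap]
    rfl
  · rw [(hgc.hasFDerivAt_convolution_right L hK hg1 x).fderiv]
    simp_rw [convolution_precompR_apply L hK (hgc.fderiv ℝ) (hg1.continuous_fderiv one_ne_zero)]
    exact sum_clifford_integral_greenKernel hn hcl hg1 hgc x

/-- Away from a ball on which the density vanishes the kernel may be cut off to a smooth one. -/
theorem exists_cutoff_greenKernel (γ : Fin n → V →L[ℝ] V) {r R : ℝ} (hr : 0 < r) (hrR : r < R) :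
    ∃ K : EuclideanSpace ℝ (Fin n) → V →L[ℝ] V, ContDiff ℝ (⊤ : ℕ∞) K ∧ HasCompactSupport K ∧
      ∀ z, r ≤ ‖z‖ → ‖z‖ ≤ R → K =ᶠ[𝓝 z] greenKernel γ 0 := by
  let f₀ : ContDiffBump (0 : EuclideanSpace ℝ (Fin n)) :=
    ⟨r / 4, r / 2, by positivity, by linarith⟩
  let f₁ : ContDiffBump (0 : EuclideanSpace ℝ (Fin n)) :=
    ⟨R + 1, R + 2, by linarith, by linarith⟩
  refine ⟨fun z => (f₁ z - f₀ z) • greenKernel γ 0 z, ?_, ?_, ?_⟩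
  · refine contDiff_iff_contDiffAt.2 fun z => ?_
    rcases eq_or_ne z 0 with rfl | hz
    · have h : (fun z => (f₁ z - f₀ z) • greenKernel γ 0 z) =ᶠ[𝓝 0] fun _ => 0 := by
        filter_upwards [f₀.eventuallyEq_one, f₁.eventuallyEq_one] with z h0 h1
        simp [h0, h1]
      exact contDiffAt_const.congr_of_eventuallyEq h
    · refine (f₁.contDiffAt.sub f₀.contDiffAt).smul (contDiffAt_greenKernel γ 0 ?_)
      have := norm_pos_iff.2 hz
      positivity
  · exact (f₁.hasCompactSupport.sub f₀.hasCompactSupport).smul_right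
  · intro z hz hz'
    have h1 : f₁ =ᶠ[𝓝 z] 1 := f₁.eventuallyEq_one_of_mem_ball (by
      rw [mem_ball_zero_iff]
      show ‖z‖ < R + 1
      linarith)
    have h0 : ∀ᶠ w in 𝓝 z, r / 2 < ‖w‖ :=
      continuous_norm.continuousAt.eventually (lt_mem_nhds (by linarith))
    filter_upwards [h1, h0] with w hw1 hw0
    have : f₀ w = 0 := f₀.zero_of_le_dist (by
      rw [dist_zero_right]
      exact hw0.le)
    simp [hw1, this]

/-- An integrable density that vanishes near `x₀` has a potential that is smooth near `x₀` and
solves the homogeneous Dirac equation there. -/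
theorem exists_potential_of_eq_zero_on_ball [CompleteSpace V] {γ : Fin n → V →L[ℝ] V}
    (hcl : ∀ i j (ψ : V), γ i (γ j ψ) + γ j (γ i ψ) = if i = j then (-2 : ℝ) • ψ else 0)
    {a : EuclideanSpace ℝ (Fin n) → V} (ha : LocallyIntegrable a volume) (hac : HasCompactSupport a)
    {x₀ : EuclideanSpace ℝ (Fin n)} {ρ : ℝ} (hρ : 0 < ρ) (haρ : ∀ y ∈ ball x₀ ρ, a y = 0) :
    ∃ b : EuclideanSpace ℝ (Fin n) → V, ContDiff ℝ (⊤ : ℕ∞) b ∧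
      (∀ x ∈ ball x₀ (ρ / 2), Integrable (fun y => greenKernel γ 0 (x - y) (a y)) volume ∧
        ∫ y, greenKernel γ 0 (x - y) (a y) = b x) ∧
      ∑ i, γ i (fderiv ℝ b x₀ (EuclideanSpace.single i 1)) = 0 := by
  obtain ⟨R, hR⟩ := hac.isCompact.isBounded.subset_closedBall x₀
  obtain ⟨K, hK, hKc, hKeq⟩ := exists_cutoff_greenKernel γ (r := ρ / 2)
    (R := max R 0 + ρ) (by positivity) (by linarith [le_max_right R 0])
  have hK1 : ContDiff ℝ 1 K := hK.of_le (by exact_mod_cast le_top)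
  have hev : ∀ x ∈ ball x₀ (ρ / 2), ∀ y, a y ≠ 0 → K =ᶠ[𝓝 (x - y)] greenKernel γ 0 := by
    intro x hx y hy
    have h1 : ρ ≤ dist y x₀ := by
      by_contra! h
      exact hy (haρ y h)
    have h2 : dist y x₀ ≤ R := hR (subset_tsupport a hy)
    rw [mem_ball] at hx
    rw [dist_comm] at h1 h2
    have h3 := dist_triangle_left x₀ y x
    have h4 := dist_triangle_right x y x₀
    rw [dist_comm y x₀] at h4
    refine hKeq _ ?_ ?_ <;> rw [← dist_eq_norm]
    · linarith
    · linarith [le_max_left R 0]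
  set L := (ContinuousLinearMap.id ℝ (V →L[ℝ] V)).flip
  have hpt : ∀ x ∈ ball x₀ (ρ / 2), ∀ y, K (x - y) (a y) = greenKernel γ 0 (x - y) (a y) := by
    intro x hx y
    by_cases hy : a y = 0
    · simp [hy]
    · rw [(hev x hx y hy).eq_of_nhds]
  refine ⟨a ⋆[L] K, hKc.contDiff_convolution_right L ha hK, fun x hx => ?_, ?_⟩
  · simp_rw [← hpt x hx]
    exact ⟨(hKc.convolutionExists_right L ha hK.continuous x).integrable, rfl⟩
  · have hK' := hK1.continuous_fderiv one_ne_zero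
    rw [(hKc.hasFDerivAt_convolution_right L ha hK1 x₀).fderiv]
    simp_rw [convolution_precompR_apply L ha (hKc.fderiv ℝ) hK']
    have hint : ∀ i : Fin n, Integrable (fun y =>
        fderiv ℝ K (x₀ - y) (EuclideanSpace.single i 1) (a y)) volume := fun i =>
      ((hKc.fderiv_apply ℝ (EuclideanSpace.single i 1)).convolutionExists_right L ha
        (hK'.clm_apply continuous_const) x₀).integrable
    change ∑ i, γ i (∫ y, fderiv ℝ K (x₀ - y) (EuclideanSpace.single i 1) (a y)) = 0
    simp_rw [← ContinuousLinearMap.integral_comp_comm _ (hint _)]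
    rw [← integral_finsetSum _ fun i _ => (γ i).integrable_comp (hint i)]
    refine integral_eq_zero_of_ae (Eventually.of_forall fun y => ?_)
    by_cases hy : a y = 0
    · simp [hy]
    · have hx₀ : x₀ ∈ ball x₀ (ρ / 2) := mem_ball_self (by positivity)
      have hne : x₀ - y ≠ 0 := by
        intro h
        exact hy (haρ y (by rw [← sub_eq_zero.1 h]; exact mem_ball_self hρ))
      have hpos : 0 < ‖x₀ - y‖ ^ 2 + 0 := by
        have := norm_pos_iff.2 hne
        positivity
      simp only [(hev x₀ hx₀ y hy).fderiv_eq]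
      rw [sum_clifford_fderiv_greenKernel hcl 0 hpos]
      simp

theorem aestronglyMeasurable_of_continuousOn_compl_singleton (hn : 1 ≤ n)
    {α : EuclideanSpace ℝ (Fin n) → V} {p : EuclideanSpace ℝ (Fin n)}
    (hα : ContinuousOn α {p}ᶜ) : AEStronglyMeasurable α volume := by
  have : Nonempty (Fin n) := ⟨⟨0, hn⟩⟩
  rw [← restrict_compl_singleton (μ := volume) p]
  exact hα.aestronglyMeasurable (measurableSet_singleton p).compl

/-- Near a point `x₀ ≠ 0` the convolution of the kernel with `α` is smooth, and at `x₀` it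
solves the Dirac equation. -/
theorem exists_local_potential [CompleteSpace V] (hn : 1 ≤ n) {γ : Fin n → V →L[ℝ] V}
    (hcl : ∀ i j (ψ : V), γ i (γ j ψ) + γ j (γ i ψ) = if i = j then (-2 : ℝ) • ψ else 0)
    {α : EuclideanSpace ℝ (Fin n) → V} (hsupp : HasCompactSupport α)
    (hα : ContDiffOn ℝ (⊤ : ℕ∞) α {0}ᶜ) (hloc : LocallyIntegrable α volume)
    {x₀ : EuclideanSpace ℝ (Fin n)} (hx₀ : x₀ ≠ 0) :
    ∃ b : EuclideanSpace ℝ (Fin n) → V, ContDiff ℝ (⊤ : ℕ∞) b ∧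
      (∀ᶠ x in 𝓝 x₀, Integrable (fun y => greenKernel γ 0 (x - y) (α y)) volume ∧
        ∫ y, greenKernel γ 0 (x - y) (α y) = b x) ∧
      ∑ i, γ i (fderiv ℝ b x₀ (EuclideanSpace.single i 1)) = -(sphereVol n • α x₀) := by
  have hpos : 0 < ‖x₀‖ := norm_pos_iff.2 hx₀
  let χ : ContDiffBump x₀ := ⟨‖x₀‖ / 4, ‖x₀‖ / 2, by positivity, by linarith⟩
  set g : EuclideanSpace ℝ (Fin n) → V := fun y => χ y • α y with hgdef
  have hg : ContDiff ℝ (⊤ : ℕ∞) g := by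
    refine contDiff_iff_contDiffAt.2 fun y => ?_
    rcases eq_or_ne y 0 with rfl | hy
    · have h : (0 : EuclideanSpace ℝ (Fin n)) ∉ tsupport χ := by
        rw [χ.tsupport_eq, mem_closedBall, dist_zero_left]
        show ¬ ‖x₀‖ ≤ ‖x₀‖ / 2
        linarith
      have h' : g =ᶠ[𝓝 0] fun _ => 0 := by
        filter_upwards [notMem_tsupport_iff_eventuallyEq.1 h] with y hy
        simp [hgdef, hy]
      exact contDiffAt_const.congr_of_eventuallyEq h'
    · exact χ.contDiffAt.smul (hα.contDiffAt (isOpen_compl_singleton.mem_nhds hy))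
  have hgc : HasCompactSupport g := χ.hasCompactSupport.smul_right
  have hχ : ∀ y ∈ ball x₀ (‖x₀‖ / 4), χ y = 1 := fun y hy =>
    χ.one_of_mem_closedBall (ball_subset_closedBall hy)
  obtain ⟨b₁, hb₁, hb₁i, hb₁d⟩ := exists_potential_of_contDiff hn hcl hg hgc
  obtain ⟨b₂, hb₂, hb₂i, hb₂d⟩ := exists_potential_of_eq_zero_on_ball hcl
    (a := α - g) (hloc.sub hg.continuous.locallyIntegrable) (hsupp.sub hgc)
    (x₀ := x₀) (ρ := ‖x₀‖ / 4) (by positivity) (fun y hy => by simp [hgdef, hχ y hy])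
  have hsplit : ∀ x y, greenKernel γ 0 (x - y) (α y) =
      greenKernel γ 0 (x - y) (g y) + greenKernel γ 0 (x - y) ((α - g) y) := by
    intro x y
    rw [← map_add, Pi.sub_apply, add_sub_cancel]
  refine ⟨b₁ + b₂, hb₁.add hb₂, ?_, ?_⟩
  · filter_upwards [ball_mem_nhds x₀ (show 0 < ‖x₀‖ / 4 / 2 by positivity)] with x hx
    simp_rw [hsplit]
    refine ⟨(hb₁i x).1.add (hb₂i x hx).1, ?_⟩
    rw [integral_add (hb₁i x).1 (hb₂i x hx).1, (hb₁i x).2, (hb₂i x hx).2, Pi.add_apply]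
  · have htop : ((⊤ : ℕ∞) : WithTop ℕ∞) ≠ 0 := by simp
    rw [fderiv_add (hb₁.differentiable htop x₀) (hb₂.differentiable htop x₀)]
    simp only [add_apply, map_add, Finset.sum_add_distrib]
    rw [hb₁d, hb₂d, add_zero, hgdef]
    simp [hχ x₀ (mem_ball_self (by positivity))]

end Green

theorem sphereVol_pos {n : ℕ} (hn : 1 ≤ n) : 0 < sphereVol n := by
  rw [sphereVol, Measure.toSphere_real_apply_univ, finrank_euclideanSpace_fin]
  have h : 0 < (volume : Measure (EuclideanSpace ℝ (Fin n))).real (Metric.ball 0 1) :=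
    ENNReal.toReal_pos (Metric.measure_ball_pos _ _ one_pos).ne' measure_ball_lt_top.ne
  have : (0 : ℝ) < n := by exact_mod_cast hn
  positivity

theorem stmt9 (n : ℕ) (hn : 3 ≤ n) (V : Type*) [NormedAddCommGroup V]
    [InnerProductSpace ℂ V] [FiniteDimensional ℂ V] [Nontrivial V]
    (γ : Fin n → V →ₗ[ℂ] V)
    (hcl : ∀ i j (ψ : V), γ i (γ j ψ) + γ j (γ i ψ) =
      if i = j then (-2 : ℂ) • ψ else 0)
    (hsk : ∀ i (φ ψ : V), ⟪γ i φ, ψ⟫_ℂ = -⟪φ, γ i ψ⟫_ℂ)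
    (α : EuclideanSpace ℝ (Fin n) → V)
    (hsupp : HasCompactSupport α)
    (hα : ContDiffOn ℝ (⊤ : ℕ∞) α {0}ᶜ)
    (C m : ℝ) (hC : 0 < C) (hm₀ : 0 ≤ m) (hmn : m < n)
    (hbound : ∀ y : EuclideanSpace ℝ (Fin n), y ≠ 0 → ‖α y‖ ≤ C * ‖y‖ ^ (-m)) :
    (∀ x : EuclideanSpace ℝ (Fin n), x ≠ 0 →
      Integrable (fun y => greenIntegrand γ α x y) volume) ∧
    ContDiffOn ℝ (⊤ : ℕ∞) (greenConv γ α) {0}ᶜ ∧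
    (∀ x : EuclideanSpace ℝ (Fin n), x ≠ 0 → dirac γ (greenConv γ α) x = α x) := by
  have hn1 : 1 ≤ n := by omega
  have : Nonempty (Fin n) := ⟨⟨0, hn1⟩⟩
  have : CompleteSpace V := FiniteDimensional.complete ℂ V
  let γ' : Fin n → V →L[ℝ] V := fun i =>
    (LinearMap.toContinuousLinearMap (γ i)).restrictScalars ℝ
  have hγ' : ∀ i ψ, γ' i ψ = γ i ψ := fun _ _ => rfl
  have hcl' : ∀ i j (ψ : V), γ' i (γ' j ψ) + γ' j (γ' i ψ) =
      if i = j then (-2 : ℝ) • ψ else 0 := by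
    intro i j ψ
    simp only [hγ', hcl]
    split_ifs
    · rw [← Complex.coe_smul]
      norm_num
    · rfl
  have hloc : LocallyIntegrable α volume := by
    refine locallyIntegrable_of_norm_le_rpow (C := C) (α := m) (by simpa using hn1)
      (by simpa using hmn) ?_
      (aestronglyMeasurable_of_continuousOn_compl_singleton hn1 hα.continuousOn)
    filter_upwards [compl_mem_ae_iff.2 (measure_singleton (μ := volume)
      (0 : EuclideanSpace ℝ (Fin n)))] with y hy
    exact hbound y hy
  have hgreen : ∀ x y, greenIntegrand γ α x y = greenKernel γ' 0 (x - y) (α y) := by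
    intro x y
    rw [greenKernel_zero_apply, smul_apply, cliffordCLM_apply]
    rfl
  have key := fun {x₀ : EuclideanSpace ℝ (Fin n)} (hx₀ : x₀ ≠ 0) =>
    exists_local_potential hn1 hcl' hsupp hα hloc hx₀
  have hconv : ∀ {x₀ : EuclideanSpace ℝ (Fin n)} {b : EuclideanSpace ℝ (Fin n) → V},
      (∀ᶠ x in nhds x₀, Integrable (fun y => greenKernel γ' 0 (x - y) (α y)) volume ∧
        ∫ y, greenKernel γ' 0 (x - y) (α y) = b x) →
      greenConv γ α =ᶠ[nhds x₀] fun x => -((sphereVol n)⁻¹ • b x) := by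
    intro x₀ b hb
    filter_upwards [hb] with x hx
    simp only [greenConv, hgreen, hx.2]
  refine ⟨fun x hx => ?_, fun x hx => ?_, fun x hx => ?_⟩
  · obtain ⟨b, -, hb, -⟩ := key hx
    simpa only [hgreen] using hb.self_of_nhds.1
  · obtain ⟨b, hbs, hb, -⟩ := key hx
    exact ((contDiff_const.smul hbs).neg.contDiffAt.congr_of_eventuallyEq
      (hconv hb)).contDiffWithinAt
  · obtain ⟨b, hbs, hb, hbd⟩ := key hx
    have hd : HasFDerivAt (fun x => -((sphereVol n)⁻¹ • b x))
        (-((sphereVol n)⁻¹ • fderiv ℝ b x)) x :=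
      (((hbs.differentiable (by simp) x).hasFDerivAt).const_smul _).neg
    rw [dirac, (hconv hb).fderiv_eq, hd.fderiv]
    simp only [← hγ', neg_apply, smul_apply, map_neg, map_smul, Finset.sum_neg_distrib,
      ← Finset.smul_sum, hbd, smul_neg, neg_neg]
    exact inv_smul_smul₀ (sphereVol_pos hn1).ne' _
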